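/- Let G be an infinite countable amenable group, let H be a countable residually finite group, and let A be a common finite subgroup of G and H. Then the amalgamated free product G ∗_A H belongs to the class 𝒜. -/

import Mathlib

/-- A `G`-invariant mean on `X`, for the `G`-action on `X` given by `φ`:
a finitely additive probability "measure" on the subsets of `X` invariant under `G`. -/
def IsInvariantMean {G X : Type*} [Group G] (φ : G →* Equiv.Perm X)
    (μ : Set X → ℝ) : Prop :=
  (∀ S : Set X, 0 ≤ μ S) ∧ μ Set.univ = 1 ∧
  (∀ S T : Set X, Disjoint S T → μ (S ∪ T) = μ S + μ T) ∧
  (∀ (g : G) (S : Set X), μ ((φ g) '' S) = μ S)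

/-- The action of `G` on `X` given by `φ` is amenable: there is a `G`-invariant mean on `X`. -/
def AmenableAction {G X : Type*} [Group G] (φ : G →* Equiv.Perm X) : Prop :=
  ∃ μ : Set X → ℝ, IsInvariantMean φ μ

/-- A group is amenable if its left-translation action on itself is amenable. -/
def AmenableGroup (G : Type*) [Group G] : Prop :=
  AmenableAction (MulAction.toPermHom G G)

/-- A group `G` is in the class `𝒜` if it admits a transitive, faithful and
amenable action on some countable set. -/
def InClassA (G : Type*) [Group G] : Prop :=
  ∃ (X : Type) (_ : Countable X) (φ : G →* Equiv.Perm X),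
    Function.Injective φ ∧ (∀ x y : X, ∃ g : G, φ g x = y) ∧ AmenableAction φ

/-- `(P, jG, jH)` is the amalgamated free product of `G` and `H` over `A`
(along the homomorphisms `iG : A →* G` and `iH : A →* H`), i.e. it is a pushout
of `iG` and `iH` in the category of groups. -/
def IsAmalgamatedProduct {A G H P : Type*} [Group A] [Group G] [Group H] [Group P]
    (iG : A →* G) (iH : A →* H) (jG : G →* P) (jH : H →* P) : Prop :=
  jG.comp iG = jH.comp iH ∧
  ∀ (L : Type) [Group L] (fG : G →* L) (fH : H →* L),
    fG.comp iG = fH.comp iH → ∃! f : P →* L, f.comp jG = fG ∧ f.comp jH = fH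

namespace IsInvariantMean

variable {G X : Type*} [Group G] {φ : G →* Equiv.Perm X} {μ : Set X → ℝ}

theorem apply_empty (h : IsInvariantMean φ μ) : μ ∅ = 0 := by
  have := h.2.2.1 ∅ ∅ (by simp)
  simp at this
  exact this

theorem mono (h : IsInvariantMean φ μ) {S T : Set X} (hST : S ⊆ T) : μ S ≤ μ T := by
  have := h.2.2.1 S (T \ S) Set.disjoint_sdiff_right
  rw [Set.union_sdiff_cancel hST] at this
  linarith [h.1 (T \ S)]

theorem apply_union_le (h : IsInvariantMean φ μ) (S T : Set X) : μ (S ∪ T) ≤ μ S + μ T := by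
  have := h.2.2.1 S (T \ S) Set.disjoint_sdiff_right
  rw [Set.union_sdiff_self] at this
  linarith [h.mono (Set.sdiff_subset : T \ S ⊆ T)]

theorem apply_eq_sum_fibers (h : IsInvariantMean φ μ) {ι : Type*} [Fintype ι]
    (c : X → ι) (S : Set X) : μ S = ∑ i, μ {x | x ∈ S ∧ c x = i} := by
  classical
  have key (s : Finset ι) : μ {x | x ∈ S ∧ c x ∈ s} = ∑ i ∈ s, μ {x | x ∈ S ∧ c x = i} := by
    induction s using Finset.induction_on with
    | empty => simpa using h.apply_empty
    | insert a s ha ih =>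
      rw [Finset.sum_insert ha, ← ih, ← h.2.2.1]
      · congr 1
        ext x
        simp only [Finset.mem_insert, Set.mem_ofPred_eq, Set.mem_union]
        tauto
      · rw [Set.disjoint_left]
        rintro x ⟨-, rfl⟩ ⟨-, hx⟩
        exact ha hx
  simpa using key Finset.univ

theorem apply_finite_of_singleton (h : IsInvariantMean φ μ) (h₀ : ∀ x, μ {x} = 0)
    {S : Set X} (hS : S.Finite) : μ S = 0 := by
  induction S, hS using Set.Finite.induction_on with
  | empty => exact h.apply_empty
  | @insert a s _ _ ih =>
    have := h.apply_union_le {a} s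
    rw [h₀, ih, add_zero] at this
    exact le_antisymm this (h.1 _)

/-- If a mean vanishes on finite sets, it is invariant under every action which differs, for each
group element, only on a finite set. -/
theorem of_finite_ne (h : IsInvariantMean φ μ) (h₀ : ∀ S : Set X, S.Finite → μ S = 0)
    {ψ : G →* Equiv.Perm X} (hψ : ∀ g, {x | φ g x ≠ ψ g x}.Finite) : IsInvariantMean ψ μ := by
  have le_of_diff {S T : Set X} (hST : (S \ T).Finite) : μ S ≤ μ T := by
    have h1 := h.mono (show S ⊆ T ∪ (S \ T) by simp)
    have h2 := h.apply_union_le T (S \ T)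
    rw [h₀ _ hST] at h2
    linarith
  refine ⟨h.1, h.2.1, h.2.2.1, fun g S => ?_⟩
  rw [← h.2.2.2 g S]
  apply le_antisymm <;> apply le_of_diff
  · refine ((hψ g).image (ψ g)).subset ?_
    rintro _ ⟨⟨x, hx, rfl⟩, hn⟩
    exact ⟨x, fun he => hn ⟨x, hx, he⟩, rfl⟩
  · refine ((hψ g).image (φ g)).subset ?_
    rintro _ ⟨⟨x, hx, rfl⟩, hn⟩
    exact ⟨x, fun he => hn ⟨x, hx, he.symm⟩, rfl⟩

/-- A mean invariant under the action of `G` on itself vanishes on finite sets when `G` is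
infinite. -/
theorem apply_finite_of_infinite [Infinite G] {m : Set G → ℝ}
    (h : IsInvariantMean (MulAction.toPermHom G G) m) {S : Set G} (hS : S.Finite) : m S = 0 := by
  have hsing (g : G) : m {g} = m {1} := by
    have := h.2.2.2 g {1}
    simpa using this
  have hcard (s : Finset G) : m (s : Set G) = s.card * m {1} := by
    classical
    induction s using Finset.induction_on with
    | empty => simpa using h.apply_empty
    | insert a s ha ih =>
      rw [Finset.coe_insert, Set.insert_eq, h.2.2.1 _ _ (by simpa using ha), ih,
        Finset.card_insert_of_notMem ha, hsing]
      push_cast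
      ring
  have h1 : m {1} = 0 := by
    by_contra hne
    have hpos : 0 < m {1} := lt_of_le_of_ne (h.1 _) (Ne.symm hne)
    obtain ⟨n, hn⟩ := exists_nat_gt (m {1})⁻¹
    obtain ⟨s, rfl⟩ := Infinite.exists_subset_card_eq G n
    have h2 := h.mono (Set.subset_univ (s : Set G))
    rw [h.2.1, hcard] at h2
    rw [inv_lt_iff_one_lt_mul₀ hpos] at hn
    linarith
  exact h.apply_finite_of_singleton (fun g => by rw [hsing, h1]) hS

end IsInvariantMean

/-- A mean concentrated on a single orbit, together with faithfulness on that orbit, puts the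
group in the class `𝒜`. -/
theorem inClassA_of_orbit {P X : Type} [Group P] [Countable X] {φ : P →* Equiv.Perm X}
    {μ : Set X → ℝ} (hμ : IsInvariantMean φ μ) (x₀ : X) (hone : μ {x | ∃ p, φ p x₀ = x} = 1)
    (hfaith : ∀ p, p ≠ 1 → ∃ q, φ p (φ q x₀) ≠ φ q x₀) : InClassA P := by
  let _ : MulAction P X := MulAction.compHom X φ
  refine ⟨MulAction.orbit P x₀, inferInstance, MulAction.toPermHom P _, ?_, ?_,
    fun S => μ (Subtype.val '' S), fun S => hμ.1 _, ?_, ?_, ?_⟩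
  · rw [injective_iff_map_eq_one]
    intro p hp
    by_contra hne
    obtain ⟨q, hq⟩ := hfaith p hne
    have := congrArg Subtype.val (Equiv.congr_fun hp ⟨φ q x₀, q, rfl⟩)
    exact hq this
  · exact fun x y => MulAction.exists_smul_eq P x y
  · change μ (Subtype.val '' Set.univ) = 1
    rw [Set.image_univ, Subtype.range_coe]
    exact hone
  · intro S T hST
    beta_reduce
    rw [Set.image_union]
    exact hμ.2.2.1 _ _ ((Set.disjoint_image_iff Subtype.val_injective).2 hST)
  · intro p S
    beta_reduce
    rw [← hμ.2.2.2 p (Subtype.val '' S)]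
    congr 1
    ext x
    constructor
    · rintro ⟨_, ⟨y, hy, rfl⟩, rfl⟩
      exact ⟨y, ⟨y, hy, rfl⟩, rfl⟩
    · rintro ⟨_, ⟨y, hy, rfl⟩, rfl⟩
      exact ⟨_, ⟨y, hy, rfl⟩, rfl⟩

/-- A group `A` embedded in `G` acts on `G` by left translation as on a disjoint union of copies
of itself. -/
theorem exists_equiv_prod_of_injective {A G : Type} [Group A] [Group G] (i : A →* G)
    (hi : Function.Injective i) :
    ∃ (I : Type) (e : G ≃ A × I), ∀ a g, e (i a * g) = (a * (e g).1, (e g).2) := by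
  obtain ⟨T, hT, -⟩ := Subgroup.exists_isComplement_right i.range 1
  let r : A ≃* i.range := MonoidHom.ofInjective hi
  refine ⟨T, hT.equiv.trans (r.symm.toEquiv.prodCongr (Equiv.refl _)), fun a g => ?_⟩
  have := hT.equiv_mul_left (r a) g
  have hr : ((r a : i.range) : G) = i a := rfl
  rw [hr] at this
  change (r.symm (hT.equiv (i a * g)).1, (hT.equiv (i a * g)).2) =
    (a * r.symm (hT.equiv g).1, (hT.equiv g).2)
  rw [this, map_mul, r.symm_apply_apply]

/-- In a residually finite group, some normal subgroup of finite index avoids any given finite set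
of nontrivial elements. -/
theorem exists_normal_finiteIndex_disjoint {H : Type*} [Group H]
    (hres : ∀ h : H, h ≠ 1 → ∃ N : Subgroup H, N.Normal ∧ N.FiniteIndex ∧ h ∉ N)
    {T : Set H} (hT : T.Finite) (h1 : 1 ∉ T) :
    ∃ N : Subgroup H, N.Normal ∧ N.FiniteIndex ∧ ∀ h ∈ T, h ∉ N := by
  induction T, hT using Set.Finite.induction_on with
  | empty => exact ⟨⊤, inferInstance, inferInstance, by simp⟩
  | @insert a s _ _ ih =>
    simp only [Set.mem_insert_iff, not_or] at h1
    obtain ⟨N, hN, hNf, hNs⟩ := ih h1.2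
    obtain ⟨M, hM, hMf, hMa⟩ := hres a (Ne.symm h1.1)
    refine ⟨N ⊓ M, inferInstance, inferInstance, ?_⟩
    rintro h (rfl | hh) ⟨hn, hm⟩
    · exact hMa hm
    · exact hNs h hh hn

/-- The action of `G` on `A × I × J` obtained from `e : G ≃ A × I`, acting trivially on `J`. -/
def prodAction {A G I : Type*} [Group G] (e : G ≃ A × I) (J : Type*) :
    G →* Equiv.Perm (A × I × J) :=
  letI : MulAction G (A × I × J) :=
    { smul g y := ((e (g * e.symm (y.1, y.2.1))).1, (e (g * e.symm (y.1, y.2.1))).2, y.2.2)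
      one_smul y := by
        change ((e (1 * e.symm (y.1, y.2.1))).1, (e (1 * e.symm (y.1, y.2.1))).2, y.2.2) = y
        simp
      mul_smul g h y := by
        change (_, _, _) = ((e (g * e.symm ((e (h * e.symm (y.1, y.2.1))).1,
          (e (h * e.symm (y.1, y.2.1))).2))).1, (e (g * e.symm ((e (h * e.symm (y.1, y.2.1))).1,
          (e (h * e.symm (y.1, y.2.1))).2))).2, y.2.2)
        simp [mul_assoc] }
  MulAction.toPermHom G _

theorem prodAction_apply {A G I J : Type*} [Group G] (e : G ≃ A × I) (g : G)
    (a : A) (i : I) (j : J) :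
    prodAction e J g (a, i, j) =
      ((e (g * e.symm (a, i))).1, (e (g * e.symm (a, i))).2, j) := rfl

namespace IsAmalgamatedProduct

variable {A G H P : Type} [Group A] [Group G] [Group H] [Group P]
  {iG : A →* G} {iH : A →* H} {jG : G →* P} {jH : H →* P}

theorem comm (hP : IsAmalgamatedProduct iG iH jG jH) (a : A) : jG (iG a) = jH (iH a) :=
  DFunLike.congr_fun hP.1 a

theorem exists_lift (hP : IsAmalgamatedProduct iG iH jG jH) {L : Type} [Group L]
    (fG : G →* L) (fH : H →* L) (hf : ∀ a, fG (iG a) = fH (iH a)) :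
    ∃ f : P →* L, (∀ g, f (jG g) = fG g) ∧ ∀ h, f (jH h) = fH h := by
  obtain ⟨f, ⟨h1, h2⟩, -⟩ := hP.2 L fG fH (MonoidHom.ext hf)
  exact ⟨f, DFunLike.congr_fun h1, DFunLike.congr_fun h2⟩

theorem mem_of_range_le (hP : IsAmalgamatedProduct iG iH jG jH) (K : Subgroup P)
    (hG : ∀ g, jG g ∈ K) (hH : ∀ h, jH h ∈ K) (p : P) : p ∈ K := by
  obtain ⟨f, hf1, hf2⟩ := hP.exists_lift (jG.codRestrict K hG) (jH.codRestrict K hH)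
    (fun a => Subtype.ext (hP.comm a))
  have : K.subtype.comp f = MonoidHom.id P :=
    (hP.2 P jG jH hP.1).unique
      ⟨by ext g; simp [hf1], by ext g; simp [hf2]⟩ ⟨rfl, rfl⟩
  rw [← MonoidHom.id_apply P p, ← this]
  exact (f p).2

theorem countable [Countable G] [Countable H] (hP : IsAmalgamatedProduct iG iH jG jH) :
    Countable P := by
  have : Countable (FreeMonoid (G ⊕ H)) := inferInstanceAs (Countable (List (G ⊕ H)))
  have : Countable (Monoid.Coprod G H) := Monoid.Coprod.mk_surjective.countable
  refine Function.Surjective.countable (f := Monoid.Coprod.lift jG jH) fun p => ?_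
  exact hP.mem_of_range_le (Monoid.Coprod.lift jG jH).range (fun g => ⟨.inl g, by simp⟩)
    (fun h => ⟨.inr h, by simp⟩) p

theorem isInvariantMean (hP : IsAmalgamatedProduct iG iH jG jH) {X : Type*}
    {φ : P →* Equiv.Perm X} {μ : Set X → ℝ} (h0 : ∀ S : Set X, 0 ≤ μ S) (h1 : μ Set.univ = 1)
    (hadd : ∀ S T : Set X, Disjoint S T → μ (S ∪ T) = μ S + μ T)
    (hG : ∀ g S, μ (φ (jG g) '' S) = μ S) (hH : ∀ h S, μ (φ (jH h) '' S) = μ S) :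
    IsInvariantMean φ μ := by
  let K : Subgroup P :=
    { carrier := {p | ∀ S, μ (φ p '' S) = μ S}
      one_mem' := by simp
      mul_mem' := fun {p q} hp hq S => by
        rw [map_mul, Equiv.Perm.coe_mul, Set.image_comp, hp, hq]
      inv_mem' := fun {p} hp S => by
        rw [← hp, ← Set.image_comp, ← Equiv.Perm.coe_mul, ← map_mul]
        simp }
  exact ⟨h0, h1, hadd, fun p => hP.mem_of_range_le K hG hH p⟩

theorem finite_ne (hP : IsAmalgamatedProduct iG iH jG jH) {X : Type*}
    {φ ψ : P →* Equiv.Perm X} (hG : ∀ g, {x | φ (jG g) x ≠ ψ (jG g) x}.Finite)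
    (hH : ∀ h, {x | φ (jH h) x ≠ ψ (jH h) x}.Finite) (p : P) : {x | φ p x ≠ ψ p x}.Finite := by
  let K : Subgroup P :=
    { carrier := {p | {x | φ p x ≠ ψ p x}.Finite}
      one_mem' := by simp
      mul_mem' := fun {p q} hp hq => by
        refine (hq.union (hp.preimage (φ q).injective.injOn)).subset fun x hx => ?_
        by_contra hn
        simp only [Set.mem_union, Set.mem_ofPred_eq, Set.mem_preimage, not_or, not_not] at hn
        apply hx
        rw [map_mul, map_mul, Equiv.Perm.mul_apply, Equiv.Perm.mul_apply, hn.2, hn.1]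
      inv_mem' := fun {p} hp => by
        refine (hp.image (ψ p)).subset fun x hx => ⟨ψ p⁻¹ x, fun he => hx ?_, by simp⟩
        rw [map_inv, Equiv.Perm.inv_eq_iff_eq, he]
        simp }
  exact hP.mem_of_range_le K hG hH p

end IsAmalgamatedProduct

/-- The action of `Q` on `A × I × J` obtained from `e : Q ≃ A × J`, acting trivially on `I`. -/
def prodActionSwap {A Q J : Type*} [Group Q] (e : Q ≃ A × J) (I : Type*) :
    Q →* Equiv.Perm (A × I × J) :=
  ((Equiv.refl A).prodCongr (Equiv.prodComm J I)).permCongrHom.toMonoidHom.comp (prodAction e I)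

theorem prodActionSwap_apply {A Q I J : Type*} [Group Q] (e : Q ≃ A × J) (q : Q)
    (a : A) (i : I) (j : J) :
    prodActionSwap e I q (a, i, j) =
      ((e (q * e.symm (a, j))).1, i, (e (q * e.symm (a, j))).2) := rfl

section AveragedMean

variable {A G I J : Type*} [Fintype J]

/-- The mean on `A × I × J` obtained by averaging over `J` copies of a mean on `G ≃ A × I`. -/
noncomputable def averagedMean (m : Set G → ℝ) (e : G ≃ A × I) (S : Set (A × I × J)) : ℝ :=
  (∑ j, m {g | ((e g).1, (e g).2, j) ∈ S}) / Fintype.card J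

variable {m : Set G → ℝ} {e : G ≃ A × I}

theorem averagedMean_finite (h₀ : ∀ S : Set G, S.Finite → m S = 0) {S : Set (A × I × J)}
    (hS : S.Finite) : averagedMean m e S = 0 := by
  unfold averagedMean
  rw [Finset.sum_eq_zero, zero_div]
  intro j _
  refine h₀ _ (hS.preimage (f := fun g => ((e g).1, (e g).2, j)) fun g _ g' _ hg => ?_)
  simp only [Prod.mk.injEq, and_true] at hg
  exact e.injective (Prod.ext hg.1 hg.2)

theorem averagedMean_prodAction [Group G] (hm : IsInvariantMean (MulAction.toPermHom G G) m) (g : G)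
    (S : Set (A × I × J)) : averagedMean m e (prodAction e J g '' S) = averagedMean m e S := by
  unfold averagedMean
  congr 1
  refine Finset.sum_congr rfl fun j _ => ?_
  rw [← hm.2.2.2 g {x | ((e x).1, (e x).2, j) ∈ S}]
  congr 1
  ext x
  simp only [Set.mem_image, Set.mem_ofPred_eq, MulAction.toPermHom_apply,
    MulAction.toPerm_apply, smul_eq_mul]
  constructor
  · rintro ⟨⟨a, i, j'⟩, hS, heq⟩
    rw [prodAction_apply] at heq
    simp only [Prod.mk.injEq] at heq
    obtain ⟨h1, h2, rfl⟩ := heq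
    exact ⟨e.symm (a, i), by simpa using hS, e.injective (Prod.ext h1 h2)⟩
  · rintro ⟨y, hy, rfl⟩
    exact ⟨_, hy, by simp [prodAction_apply]⟩

theorem averagedMean_eq_sum [Group G] [Group A] [Fintype A]
    (hm : IsInvariantMean (MulAction.toPermHom G G) m) (iG : A →* G)
    (he : ∀ a g, e (iG a * g) = (a * (e g).1, (e g).2)) (S : Set (A × I × J)) :
    averagedMean m e S =
      (∑ x : A × J, m {g | (e g).1 = 1 ∧ (x.1, (e g).2, x.2) ∈ S}) / Fintype.card J := by
  unfold averagedMean
  rw [Fintype.sum_prod_type_right]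
  congr 1
  refine Finset.sum_congr rfl fun j _ => ?_
  rw [hm.apply_eq_sum_fibers (fun g => (e g).1)]
  refine Finset.sum_congr rfl fun a _ => ?_
  rw [← hm.2.2.2 (iG a) {g | (e g).1 = 1 ∧ (a, (e g).2, j) ∈ S}]
  congr 1
  ext x
  simp only [Set.mem_image, Set.mem_ofPred_eq, MulAction.toPermHom_apply,
    MulAction.toPerm_apply, smul_eq_mul]
  constructor
  · rintro ⟨hx, rfl⟩
    refine ⟨iG (e x).1⁻¹ * x, ⟨by rw [he, inv_mul_cancel], by rwa [he]⟩, by simp⟩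
  · rintro ⟨y, ⟨h1, hy⟩, rfl⟩
    simpa [he, h1] using hy

theorem averagedMean_prodActionSwap [Group G] [Group A] [Fintype A] {Q : Type*} [Group Q]
    (hm : IsInvariantMean (MulAction.toPermHom G G) m) (iG : A →* G)
    (he : ∀ a g, e (iG a * g) = (a * (e g).1, (e g).2)) (e' : Q ≃ A × J) (q : Q)
    (S : Set (A × I × J)) :
    averagedMean m e (prodActionSwap e' I q '' S) = averagedMean m e S := by
  rw [averagedMean_eq_sum hm iG he, averagedMean_eq_sum hm iG he]
  congr 1
  rw [← Equiv.sum_comp ((e'.symm.trans (Equiv.mulLeft q)).trans e')]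
  refine Finset.sum_congr rfl fun x _ => ?_
  congr 1
  ext g
  simp only [Set.mem_ofPred_eq, and_congr_right_iff]
  intro _
  rw [← (prodActionSwap e' I q).injective.mem_set_image (s := S)]
  rfl

end AveragedMean

/-- Two disjoint injective families can be exchanged by a permutation fixing everything else. -/
theorem exists_perm_exchanging {A X : Type*} {u v : A → X} (hu : Function.Injective u)
    (hv : Function.Injective v) (huv : ∀ a b, u a ≠ v b) :
    ∃ σ : Equiv.Perm X, (∀ a, σ (u a) = v a) ∧ (∀ a, σ (v a) = u a) ∧
      ∀ x, (∀ a, u a ≠ x) → (∀ a, v a ≠ x) → σ x = x := by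
  let w : A ⊕ A ↪ X := ⟨Sum.elim u v, hu.sumElim hv huv⟩
  refine ⟨Equiv.Perm.viaEmbedding (Equiv.sumComm A A) w,
    fun a => Equiv.Perm.viaEmbedding_apply _ w (.inl a),
    fun a => Equiv.Perm.viaEmbedding_apply _ w (.inr a),
    fun x h1 h2 => Equiv.Perm.viaEmbedding_apply_of_notMem _ w x ?_⟩
  rintro ⟨a | a, rfl⟩
  · exact h1 a rfl
  · exact h2 a rfl

/-- Given an amenable action `ψ` of an amalgamated product on `Y`, link `Y` to the regular action
by exchanging one `A`-orbit of `Y` with one of the regular action. The resulting action is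
faithful, and stays amenable as only finitely many points are affected. -/
theorem inClassA_of_link {A G H P Y : Type} [Group A] [Group G] [Group H] [Group P]
    [Finite A] [Infinite G] [Countable P] [Countable Y]
    {iG : A →* G} {iH : A →* H} {jG : G →* P} {jH : H →* P}
    (hP : IsAmalgamatedProduct iG iH jG jH) (hiG : Function.Injective iG)
    (hjG : Function.Injective jG) (h₀ : H) (hh₀ : ∀ a, jG (iG a) ≠ jH h₀)
    {ψ : P →* Equiv.Perm Y} {μ : Set Y → ℝ} (hμ : IsInvariantMean ψ μ)
    (hfin : ∀ S : Set Y, S.Finite → μ S = 0) (y₀ : Y)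
    (hfree : Function.Injective fun a => ψ (jG (iG a)) y₀)
    (hconn : ∀ O : Set Y, y₀ ∈ O → (∀ g, ∀ y ∈ O, ψ (jG g) y ∈ O) →
      (∀ h, ∀ y ∈ O, (∀ a, ψ (jG (iG a)) y₀ ≠ y) → (∀ a, ψ (jG (iG a)) y₀ ≠ ψ (jH h) y) →
        ψ (jH h) y ∈ O) → ∀ y, y ∈ O) :
    InClassA P := by
  let φ : P →* Equiv.Perm (Y ⊕ P) :=
    (Equiv.Perm.sumCongrHom Y P).comp (ψ.prod (MulAction.toPermHom P P))
  have φl (p : P) (y : Y) : φ p (.inl y) = .inl (ψ p y) := rfl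
  have φr (p q : P) : φ p (.inr q) = .inr (p * q) := rfl
  let u : A → Y ⊕ P := fun a => .inl (ψ (jG (iG a)) y₀)
  let v : A → Y ⊕ P := fun a => .inr (jG (iG a))
  have φu (a b : A) : φ (jG (iG a)) (u b) = u (a * b) := by
    simp only [u, φl, map_mul, Equiv.Perm.mul_apply]
  have φv (a b : A) : φ (jG (iG a)) (v b) = v (a * b) := by
    simp only [v, φr, map_mul]
  obtain ⟨σ, σu, σv, σfix⟩ := exists_perm_exchanging (u := u) (v := v)
    (Sum.inl_injective.comp hfree) (Sum.inr_injective.comp (hjG.comp hiG)) (fun a b => by simp [u, v])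
  have σsupp : {x | σ x ≠ x}.Finite := by
    refine ((Set.finite_range u).union (Set.finite_range v)).subset fun x hx => ?_
    by_contra hn
    simp only [Set.mem_union, Set.mem_range, not_or, not_exists] at hn
    exact hx (σfix x hn.1 hn.2)
  have σinv_fix (x : Y ⊕ P) (h : σ x = x) : σ⁻¹ x = x := by
    rw [Equiv.Perm.inv_eq_iff_eq, h]
  have σcomm (a : A) (x : Y ⊕ P) : σ (φ (jG (iG a)) x) = φ (jG (iG a)) (σ x) := by
    by_cases hu : ∃ b, u b = x
    · obtain ⟨b, rfl⟩ := hu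
      rw [φu, σu, σu, φv]
    by_cases hv : ∃ b, v b = x
    · obtain ⟨b, rfl⟩ := hv
      rw [φv, σv, σv, φu]
    have key (w : A → Y ⊕ P) (hw : ∀ b, φ (jG (iG a)) (w b) = w (a * b))
        (hx : ¬ ∃ b, w b = x) (b : A) : w b ≠ φ (jG (iG a)) x := fun hb =>
      hx ⟨a⁻¹ * b, (φ (jG (iG a))).injective (by rw [hw, mul_inv_cancel_left, hb])⟩
    rw [σfix _ (key u (φu a) hu) (key v (φv a) hv),
      σfix x (fun b hb => hu ⟨b, hb⟩) (fun b hb => hv ⟨b, hb⟩)]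
  obtain ⟨ρ, ρG, ρH⟩ := hP.exists_lift (φ.comp jG)
    ((MulAut.conj σ).toMonoidHom.comp (φ.comp jH)) (fun a => by
      ext1 x
      change φ (jG (iG a)) x = (σ * φ (jH (iH a)) * σ⁻¹) x
      rw [← hP.comm, Equiv.Perm.mul_apply, Equiv.Perm.mul_apply, σcomm]
      simp)
  have ρG (g : G) : ρ (jG g) = φ (jG g) := ρG g
  have ρH (h : H) (x : Y ⊕ P) : ρ (jH h) x = σ (φ (jH h) (σ⁻¹ x)) := by rw [ρH]; rfl
  have hne (p : P) : {x | φ p x ≠ ρ p x}.Finite := by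
    refine hP.finite_ne (fun g => ?_) (fun h => ?_) p
    · simp [ρG]
    · refine (σsupp.union (σsupp.preimage (φ (jH h)).injective.injOn)).subset fun x hx => ?_
      by_contra hn
      simp only [Set.mem_union, Set.mem_ofPred_eq, Set.mem_preimage, not_or, not_not] at hn
      apply hx
      rw [ρH, σinv_fix x hn.1, hn.2]
  have hX : IsInvariantMean φ fun S => μ (Sum.inl ⁻¹' S) := by
    refine ⟨fun S => hμ.1 _, hμ.2.1, fun S T hST => ?_, fun p S => ?_⟩
    · exact hμ.2.2.1 _ _ (hST.preimage _)
    · beta_reduce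
      rw [← hμ.2.2.2 p (Sum.inl ⁻¹' S)]
      congr 1
      ext y
      constructor
      · rintro ⟨y' | q, hy, heq⟩
        · exact ⟨y', hy, Sum.inl_injective heq⟩
        · cases heq
      · rintro ⟨y', hy, rfl⟩
        exact ⟨.inl y', hy, rfl⟩
  have hρ : IsInvariantMean ρ fun S => μ (Sum.inl ⁻¹' S) :=
    hX.of_finite_ne (fun S hS => hfin _ (hS.preimage Sum.inl_injective.injOn)) hne
  have hu1 : u 1 = .inl y₀ := by simp [u]
  refine inClassA_of_orbit hρ (.inl y₀) ?_ fun p hp => ?_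
  · rw [← hμ.2.1]
    congr 1
    refine Set.eq_univ_of_forall (hconn _ ⟨1, by simp⟩ ?_ ?_)
    · rintro g y ⟨q, hq⟩
      exact ⟨jG g * q, by rw [map_mul, Equiv.Perm.mul_apply, hq, ρG, φl]⟩
    · rintro h y ⟨q, hq⟩ h1 h2
      refine ⟨jH h * q, ?_⟩
      have σl (z : Y) (hz : ∀ a, ψ (jG (iG a)) y₀ ≠ z) : σ (.inl z) = .inl z :=
        σfix _ (fun a ha => hz a (Sum.inl_injective ha)) (by simp [v])
      rw [map_mul, Equiv.Perm.mul_apply, hq, ρH, σinv_fix _ (σl y h1), φl, σl _ h2]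
  · have hmove (g : G) : ρ (jG g * jH h₀) (.inl y₀) = .inr (jG g * jH h₀) := by
      have h1 : σ⁻¹ (.inl y₀) = v 1 := by rw [Equiv.Perm.inv_eq_iff_eq, σv, hu1]
      have h2 : φ (jH h₀) (v 1) = .inr (jH h₀) := by simp [v, φr]
      rw [map_mul, Equiv.Perm.mul_apply, ρH, h1, h2,
        σfix _ (by simp [u]) (fun a ha => hh₀ a (Sum.inr_injective ha)), ρG, φr]
    have hinj : Function.Injective fun g => (Sum.inr (jG g * jH h₀) : Y ⊕ P) :=
      fun g g' hg => hjG (mul_right_cancel (Sum.inr_injective hg))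
    obtain ⟨_, ⟨g, rfl⟩, hg⟩ := (Set.infinite_range_of_injective hinj).exists_notMem_finite (hne p)
    refine ⟨jG g * jH h₀, ?_⟩
    simp only [Set.mem_ofPred_eq, not_not] at hg
    rw [hmove, ← hg, φr]
    simpa using hp

namespace IsAmalgamatedProduct

variable {A G H P : Type} [Group A] [Group G] [Group H] [Group P]
  {iG : A →* G} {iH : A →* H} {jG : G →* P} {jH : H →* P}

theorem inClassA_of_surjective [Countable G] [Countable H]
    (hP : IsAmalgamatedProduct iG iH jG jH) (hG : AmenableGroup G)
    (hiH : Function.Injective iH) (hsurj : Function.Surjective iH) : InClassA P := by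
  obtain ⟨m, hm⟩ := hG
  have := hP.countable
  have jG_surj (p : P) : ∃ g, jG g = p :=
    hP.mem_of_range_le jG.range (fun g => ⟨g, rfl⟩)
      (fun h => by obtain ⟨a, rfl⟩ := hsurj h; exact ⟨iG a, hP.comm a⟩) p
  let r : A ≃* H := MulEquiv.ofBijective iH ⟨hiH, hsurj⟩
  obtain ⟨f, hf, -⟩ := hP.exists_lift (MonoidHom.id G) (iG.comp r.symm.toMonoidHom) fun a => by
    have : r.symm (iH a) = a := r.symm_apply_apply a
    simp [this]
  have jG_f (p : P) : jG (f p) = p := by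
    obtain ⟨g, rfl⟩ := jG_surj p
    rw [hf, MonoidHom.id_apply]
  refine inClassA_of_orbit (φ := MulAction.toPermHom P P) (μ := fun S => m (jG ⁻¹' S))
    ⟨fun S => hm.1 _, hm.2.1, fun S T hST => hm.2.2.1 _ _ (hST.preimage _), fun p S => ?_⟩ 1
    ?_ fun p hp => ⟨1, by simpa using hp⟩
  · beta_reduce
    rw [← hm.2.2.2 (f p) (jG ⁻¹' S)]
    congr 1
    ext g
    simp only [Set.mem_image, Set.mem_preimage, MulAction.toPermHom_apply,
      MulAction.toPerm_apply, smul_eq_mul]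
    constructor
    · rintro ⟨q, hq, heq⟩
      refine ⟨f q, by rwa [jG_f], ?_⟩
      rw [← map_mul, heq, hf, MonoidHom.id_apply]
    · rintro ⟨g, hg, rfl⟩
      exact ⟨jG g, hg, by rw [map_mul, jG_f]⟩
  · rw [← hm.2.1]
    congr 1
    exact Set.eq_univ_of_forall fun g => ⟨jG g, by simp⟩

theorem inClassA_of_not_surjective [Countable G] [Countable H] [Finite A] [Infinite G]
    (hP : IsAmalgamatedProduct iG iH jG jH) (hG : AmenableGroup G)
    (hres : ∀ h : H, h ≠ 1 → ∃ N : Subgroup H, N.Normal ∧ N.FiniteIndex ∧ h ∉ N)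
    (hiG : Function.Injective iG) (hiH : Function.Injective iH)
    (hsurj : ¬ Function.Surjective iH) : InClassA P := by
  obtain ⟨m, hm⟩ := hG
  have := hP.countable
  have := Fintype.ofFinite A
  simp only [Function.Surjective, not_forall, not_exists] at hsurj
  obtain ⟨h₀, hh₀⟩ := hsurj
  obtain ⟨N, hN, hNf, hNT⟩ := exists_normal_finiteIndex_disjoint hres
    (T := (iH '' {a | a ≠ 1}) ∪ Set.range fun a => (iH a)⁻¹ * h₀)
    (((Set.toFinite _).image _).union (Set.finite_range _)) (by
      rintro (⟨a, ha, h1⟩ | ⟨a, ha⟩)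
      · exact ha (hiH (by rw [h1, map_one]))
      · exact hh₀ a (inv_mul_eq_one.1 ha))
  let π : H →* H ⧸ N := QuotientGroup.mk' N
  have hπA : Function.Injective (π.comp iH) := by
    rw [injective_iff_map_eq_one]
    intro a ha
    by_contra hne
    exact hNT _ (.inl ⟨a, hne, rfl⟩) ((QuotientGroup.eq_one_iff _).1 ha)
  have hπh₀ (a : A) : π (iH a) ≠ π h₀ := fun h =>
    hNT _ (.inr ⟨a, rfl⟩) (QuotientGroup.eq.1 h)
  obtain ⟨I, e, he⟩ := exists_equiv_prod_of_injective iG hiG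
  obtain ⟨J, e', he'⟩ := exists_equiv_prod_of_injective _ hπA
  have he' (a : A) (q : H ⧸ N) : e' (π (iH a) * q) = (a * (e' q).1, (e' q).2) := he' a q
  have : Infinite I := by
    by_contra hI
    have := not_infinite_iff_finite.1 hI
    exact not_finite_iff_infinite.2 ‹Infinite G› (Finite.of_equiv _ e.symm)
  have : Countable I := (e.symm.injective.comp (Prod.mk_right_injective (1 : A))).countable
  have : Finite J := .of_injective _ (e'.symm.injective.comp (Prod.mk_right_injective (1 : A)))
  have := Fintype.ofFinite J
  have hA (a b : A) (i : I) (j : J) : prodAction e J (iG a) (b, i, j) = (a * b, i, j) := by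
    simp [prodAction_apply, he]
  obtain ⟨ψ, ψG, ψH⟩ := hP.exists_lift (prodAction e J) ((prodActionSwap e' I).comp π) fun a => by
    ext1 ⟨b, i, j⟩
    simp [hA, prodActionSwap_apply, he']
  have ψH (h : H) : ψ (jH h) = prodActionSwap e' I (π h) := ψH h
  let i₀ : I := (e 1).2
  let j₀ : J := (e' 1).2
  have hψA (a : A) : ψ (jG (iG a)) (1, i₀, j₀) = (a, i₀, j₀) := by rw [ψG, hA, mul_one]
  have hjG : Function.Injective jG := by
    intro g g' hgg
    have h1 : ψ (jG g) (1, i₀, j₀) = ψ (jG g') (1, i₀, j₀) := by rw [hgg]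
    rw [ψG, ψG, prodAction_apply, prodAction_apply] at h1
    simp only [Prod.mk.injEq, and_true] at h1
    exact mul_right_cancel (e.injective (Prod.ext h1.1 h1.2))
  have hjh₀ (a : A) : jG (iG a) ≠ jH h₀ := by
    intro ha
    have h1 : ψ (jH (iH a)) (1, i₀, j₀) = ψ (jH h₀) (1, i₀, j₀) := by rw [← ha, hP.comm]
    rw [ψH, ψH, prodActionSwap_apply, prodActionSwap_apply] at h1
    simp only [Prod.mk.injEq, true_and] at h1
    exact hπh₀ a (mul_right_cancel (e'.injective (Prod.ext h1.1 h1.2)))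
  have hJ : (Fintype.card J : ℝ) ≠ 0 :=
    have : Nonempty J := ⟨j₀⟩
    Nat.cast_ne_zero.2 Fintype.card_ne_zero
  have hμ : IsInvariantMean ψ (averagedMean m e) := by
    refine hP.isInvariantMean (fun S => ?_) ?_ (fun S T hST => ?_) (fun g S => ?_) fun h S => ?_
    · exact div_nonneg (Finset.sum_nonneg fun j _ => hm.1 _) (Nat.cast_nonneg _)
    · simp [averagedMean, hm.2.1, hJ]
    · simp only [averagedMean]
      rw [← add_div, ← Finset.sum_add_distrib]
      congr 1
      exact Finset.sum_congr rfl fun j _ =>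
        hm.2.2.1 _ _ (hST.preimage fun g => ((e g).1, (e g).2, j))
    · rw [ψG, averagedMean_prodAction hm]
    · rw [ψH, averagedMean_prodActionSwap hm iG he]
  refine inClassA_of_link hP hiG hjG h₀ hjh₀ hμ
    (fun S hS => averagedMean_finite (fun T hT => hm.apply_finite_of_infinite hT) hS)
    (1, i₀, j₀) (fun a b hab => ?_) fun O hO hOG hOH => ?_
  · simp only [hψA] at hab
    exact congrArg Prod.fst hab
  · have htrans (a b : A) (i i' : I) (j : J) (h : (a, i, j) ∈ O) : (b, i', j) ∈ O := by
      have := hOG (e.symm (b, i') * (e.symm (a, i))⁻¹) _ h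
      rw [ψG, prodAction_apply] at this
      simpa using this
    obtain ⟨i₁, hi₁⟩ := exists_ne i₀
    rintro ⟨a, i, j⟩
    refine htrans 1 a i₁ i j ?_
    have hq : ψ (jH (e'.symm (1, j) * (e'.symm (1, j₀))⁻¹).out) (1, i₁, j₀) = (1, i₁, j) := by
      rw [ψH]
      have : π (e'.symm (1, j) * (e'.symm (1, j₀))⁻¹).out =
        e'.symm (1, j) * (e'.symm (1, j₀))⁻¹ := QuotientGroup.out_eq' _
      rw [this, prodActionSwap_apply]
      simp
    rw [← hq]
    refine hOH _ _ (htrans 1 1 i₀ i₁ j₀ hO) (fun b hb => ?_) fun b hb => ?_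
    · rw [hψA] at hb
      simp only [Prod.mk.injEq] at hb
      exact hi₁ hb.2.1.symm
    · rw [hψA, hq] at hb
      simp only [Prod.mk.injEq] at hb
      exact hi₁ hb.2.1.symm

end IsAmalgamatedProduct

/-- Corollary (Moon, arXiv:1003.3998, after Corollary 2.10).
Let `G` be an infinite countable amenable group, `H` a countable residually finite group,
and `A` a common finite subgroup of `G` and `H` (given by injective homomorphisms
`iG`, `iH`). Then `G ∗_A H` is in the class `𝒜`. -/
theorem amalgam_amenable_residually_finite_mem_classA
    (G H A : Type) [Group G] [Group H] [Group A]
    [Countable G] [Countable H] [Finite A] [Infinite G]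
    (hG : AmenableGroup G)
    (hres : ∀ h : H, h ≠ 1 → ∃ N : Subgroup H, N.Normal ∧ N.FiniteIndex ∧ h ∉ N)
    (iG : A →* G) (iH : A →* H)
    (hiG : Function.Injective iG) (hiH : Function.Injective iH)
    (P : Type) [Group P] (jG : G →* P) (jH : H →* P)
    (hP : IsAmalgamatedProduct iG iH jG jH) :
    InClassA P := by
  by_cases hsurj : Function.Surjective iH
  · exact hP.inClassA_of_surjective hG hiH hsurj
  · exact hP.inClassA_of_not_surjective hG hres hiG hiH hsurj
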